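/- Let G be a countable discrete amenable group, (V,‖·‖) a complete semi-normed real vector space, and π: G → Isom(V) a uniformly bounded representation. If φ ∈ M is asymptotically additive, i.e. inf_{ψ∈M_⊕} limsup_{F→G} ‖φ(F)/|F| − ψ(F)/|F|‖ = 0, then there exists an additive set map ψ ∈ M_⊕ such that lim_{F→G} ‖φ(F)/|F| − ψ(F)/|F|‖ = 0. -/

import Mathlib

open scoped Pointwise
open Filter

/-- The collection `F(G)` of non-empty finite subsets of `G`. -/
def FinG (G : Type*) := {F : Finset G // F.Nonempty}

section Defs

variable {G : Type*} [Group G] [DecidableEq G]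

/-- `F` is `(K, δ)`-invariant: `|KF Δ F| ≤ δ|F|`. -/
def IsInv (K : Finset G) (δ : ℝ) (F : Finset G) : Prop :=
  ((symmDiff (K * F) F).card : ℝ) ≤ δ * (F.card : ℝ)

/-- `G` is amenable: for every `(K, δ)` there is a `(K, δ)`-invariant nonempty finite set. -/
def AmenableG (G : Type*) [Group G] [DecidableEq G] : Prop :=
  ∀ K : Finset G, K.Nonempty → ∀ δ : ℝ, 0 < δ →
    ∃ F : Finset G, F.Nonempty ∧ IsInv K δ F

/-- `limsup_{F → G} φ(F) = inf_{(K,δ)} sup {φ(F) : F is (K,δ)-invariant}` (in the extended reals). -/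
noncomputable def limsupG (φ : FinG G → ℝ) : EReal :=
  ⨅ (K : {K : Finset G // K.Nonempty}) (δ : {d : ℝ // 0 < d}),
    ⨆ F : {F : FinG G // IsInv K.1 δ.1 F.1}, (φ F.1 : EReal)

/-- `liminf_{F → G} φ(F) = sup_{(K,δ)} inf {φ(F) : F is (K,δ)-invariant}` (in the extended reals). -/
noncomputable def liminfG (φ : FinG G → ℝ) : EReal :=
  ⨆ (K : {K : Finset G // K.Nonempty}) (δ : {d : ℝ // 0 < d}),
    ⨅ F : {F : FinG G // IsInv K.1 δ.1 F.1}, (φ F.1 : EReal)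

/-- `lim_{F → G} φ(F) = L`. -/
def TendstoG (φ : FinG G → ℝ) (L : ℝ) : Prop :=
  ∀ ε : ℝ, 0 < ε → ∃ (K : Finset G) (δ : ℝ), K.Nonempty ∧ 0 < δ ∧
    ∀ F : FinG G, IsInv K δ F.1 → |φ F - L| < ε

/-- A (left) Følner sequence: `|F_n Δ g F_n| / |F_n| → 0` for every `g ∈ G`. -/
def FolnerSeq (F : ℕ → FinG G) : Prop :=
  ∀ g : G, Filter.Tendsto
    (fun n => ((symmDiff ((F n).1.image (fun h => g * h)) (F n).1).card : ℝ) / ((F n).1.card : ℝ))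
    Filter.atTop (nhds (0 : ℝ))

variable {V : Type*} [SeminormedAddCommGroup V] [NormedSpace ℝ V]

/-- The representation `π` is uniformly bounded with constant `C`. -/
def UnifBdd (π : G →* (V ≃L[ℝ] V)) (C : ℝ) : Prop :=
  ∀ (g : G) (v : V), ‖π g v‖ ≤ C * ‖v‖

/-- The representation `π` is isometric (`C_π = 1`). -/
def IsIsometric (π : G →* (V ≃L[ℝ] V)) : Prop :=
  ∀ (g : G) (v : V), ‖π g v‖ = ‖v‖

/-- The ergodic sum `S_F v = Σ_{g ∈ F} π(g⁻¹) v`. -/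
noncomputable def SF (π : G →* (V ≃L[ℝ] V)) (F : Finset G) (v : V) : V :=
  ∑ g ∈ F, π g⁻¹ v

/-- The ergodic average `A_F v = |F|⁻¹ • S_F v`. -/
noncomputable def AF (π : G →* (V ≃L[ℝ] V)) (F : Finset G) (v : V) : V :=
  (F.card : ℝ)⁻¹ • SF π F v

/-- Right translation `g • F = F g⁻¹` on nonempty finite subsets. -/
def rT (g : G) (F : FinG G) : FinG G :=
  ⟨F.1.image (fun h => h * g⁻¹), F.2.image (fun h => h * g⁻¹)⟩

/-- `G`-equivariance of a set map: `π(g) φ(F) = φ(F g⁻¹)`. -/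
def IsEquivariant (π : G →* (V ≃L[ℝ] V)) (φ : FinG G → V) : Prop :=
  ∀ (g : G) (F : FinG G), π g (φ F) = φ (rT g F)

/-- Boundedness of a set map: `sup_F ‖φ(F)‖/|F| < ∞`. -/
def IsBddMap (φ : FinG G → V) : Prop :=
  ∃ C : ℝ, ∀ F : FinG G, ‖φ F‖ ≤ C * (F.1.card : ℝ)

/-- Membership in the space `M` of bounded `G`-equivariant set maps. -/
def MemM (π : G →* (V ≃L[ℝ] V)) (φ : FinG G → V) : Prop :=
  IsBddMap φ ∧ IsEquivariant π φ

/-- The sup seminorm `|||φ|||_sup = sup_F ‖φ(F)‖/|F|`. -/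
noncomputable def supNorm (φ : FinG G → V) : ℝ :=
  ⨆ F : FinG G, ‖φ F‖ / (F.1.card : ℝ)

/-- The asymptotic seminorm `|||φ|||_G = limsup_{F → G} ‖φ(F)‖/|F|` (in the extended reals). -/
noncomputable def normG (φ : FinG G → V) : EReal :=
  limsupG (fun F => ‖φ F‖ / (F.1.card : ℝ))

/-- Union of nonempty finite subsets. -/
def unionF (E F : FinG G) : FinG G :=
  ⟨E.1 ∪ F.1, E.2.inl⟩

/-- Additive set maps: `φ(E ⊔ F) = φ(E) + φ(F)` for disjoint `E, F`. -/
def IsAdditiveMap (φ : FinG G → V) : Prop :=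
  ∀ E F : FinG G, Disjoint E.1 F.1 → φ (unionF E F) = φ E + φ F

/-- The additive set map `S(v)(F) = S_F v`. -/
noncomputable def Smap (π : G →* (V ≃L[ℝ] V)) (v : V) : FinG G → V :=
  fun F => SF π F.1 v

/-- The coboundary subspace `L_W = span{w − π(g)w : w ∈ W, g ∈ G}`. -/
def cobSpan (π : G →* (V ≃L[ℝ] V)) (W : Set V) : Submodule ℝ V :=
  Submodule.span ℝ {x | ∃ w ∈ W, ∃ g : G, x = w - π g w}

/-- The coboundary subspace `L = L_V`. -/
def cobL (π : G →* (V ≃L[ℝ] V)) : Submodule ℝ V :=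
  cobSpan π Set.univ

/-- The quotient seminorm `‖v + U‖_U = inf_{u ∈ U} ‖v + u‖`. -/
noncomputable def qnorm (U : Set V) (v : V) : ℝ :=
  ⨅ u : U, ‖v + u.1‖

/-- `v` is an additive realization of `φ`: `lim_{F→G} ‖φ(F)/|F| − A_F v‖ = 0`. -/
def IsRealization (π : G →* (V ≃L[ℝ] V)) (φ : FinG G → V) (v : V) : Prop :=
  TendstoG (fun F => ‖(F.1.card : ℝ)⁻¹ • φ F - AF π F.1 v‖) 0

/-- `φ` is asymptotically additive: `inf_{ψ ∈ M_⊕} |||φ − ψ|||_G = 0`. -/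
def AsympAdd (π : G →* (V ≃L[ℝ] V)) (φ : FinG G → V) : Prop :=
  (⨅ ψ : {ψ : FinG G → V // MemM π ψ ∧ IsAdditiveMap ψ}, normG (φ - ψ.1)) = (0 : EReal)

/-- `φ` is asymptotically additive relative to `W`. -/
def AsympAddRel (π : G →* (V ≃L[ℝ] V)) (W : Set V) (φ : FinG G → V) : Prop :=
  (⨅ w : W, limsupG (fun F => ‖(F.1.card : ℝ)⁻¹ • φ F - AF π F.1 w.1‖)) = (0 : EReal)

/-- The quotient norm on `M_⊕ / N_⊕`. -/
noncomputable def qMplusN (π : G →* (V ≃L[ℝ] V)) (ψ : FinG G → V) : ℝ :=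
  ⨅ η : {η : FinG G → V // MemM π η ∧ IsAdditiveMap η ∧ normG η = (0 : EReal)},
    supNorm (ψ + η.1)

end Defs

open Topology

section Invariance

variable {G : Type*} [Group G] [DecidableEq G]

/-- Invariance passes to smaller nonempty sets at the cost of a factor `2`. -/
theorem IsInv.mono_left {K K' F : Finset G} {δ : ℝ} (hK : K.Nonempty) (hKK' : K ⊆ K')
    (h : IsInv K' (δ / 2) F) : IsInv K δ F := by
  obtain ⟨k, hk⟩ := hK
  have hkF : ({k} * F : Finset G).card = F.card := by simp
  have h₁ : ((K * F) \ F).card ≤ ((K' * F) \ F).card :=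
    Finset.card_le_card (Finset.sdiff_subset_sdiff (Finset.mul_subset_mul_right hKK') le_rfl)
  have h₂ : (F \ (K * F)).card ≤ (F \ ({k} * F)).card :=
    Finset.card_le_card (Finset.sdiff_subset_sdiff le_rfl
      (Finset.mul_subset_mul_right (Finset.singleton_subset_iff.2 hk)))
  have h₃ : (F \ ({k} * F)).card = (({k} * F) \ F).card :=
    Finset.card_sdiff_comm hkF.symm
  have h₄ : (({k} * F) \ F).card ≤ ((K' * F) \ F).card :=
    Finset.card_le_card (Finset.sdiff_subset_sdiff
      (Finset.mul_subset_mul_right (Finset.singleton_subset_iff.2 (hKK' hk))) le_rfl)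
  have h₅ : (symmDiff (K * F) F).card ≤ ((K * F) \ F).card + (F \ (K * F)).card :=
    Finset.card_union_le _ _
  have h₆ : ((K' * F) \ F).card ≤ (symmDiff (K' * F) F).card :=
    Finset.card_le_card Finset.subset_union_left
  have h₇ : (symmDiff (K * F) F).card ≤ 2 * (symmDiff (K' * F) F).card := by omega
  have h₈ : ((symmDiff (K * F) F).card : ℝ) ≤ 2 * (symmDiff (K' * F) F).card := by
    exact_mod_cast h₇
  unfold IsInv at *
  linarith

theorem IsInv.mono_right {K F : Finset G} {δ δ' : ℝ} (hδ : δ ≤ δ') (h : IsInv K δ F) :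
    IsInv K δ' F :=
  h.trans (by gcongr)

variable (G) in
/-- The filter of convergence `F → G`, generated by the `(K, δ)`-invariant sets. -/
def invFilter : Filter (FinG G) where
  sets := {s | ∃ (K : Finset G) (δ : ℝ), K.Nonempty ∧ 0 < δ ∧ ∀ F : FinG G, IsInv K δ F.1 → F ∈ s}
  univ_sets := ⟨{1}, 1, by simp, one_pos, fun _ _ => trivial⟩
  sets_of_superset := by
    rintro s t ⟨K, δ, hK, hδ, h⟩ hst
    exact ⟨K, δ, hK, hδ, fun F hF => hst (h F hF)⟩
  inter_sets := by
    rintro s t ⟨K, δ, hK, hδ, h⟩ ⟨K', δ', hK', hδ', h'⟩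
    refine ⟨K ∪ K', min δ δ' / 2, hK.inl, by positivity, fun F hF => ⟨h F ?_, h' F ?_⟩⟩
    · exact (hF.mono_left hK Finset.subset_union_left).mono_right (min_le_left _ _)
    · exact (hF.mono_left hK' Finset.subset_union_right).mono_right (min_le_right _ _)

theorem eventually_invFilter {p : FinG G → Prop} :
    (∀ᶠ F in invFilter G, p F) ↔
      ∃ (K : Finset G) (δ : ℝ), K.Nonempty ∧ 0 < δ ∧ ∀ F : FinG G, IsInv K δ F.1 → p F :=
  Iff.rfl

theorem AmenableG.invFilter_neBot (hG : AmenableG G) : (invFilter G).NeBot := by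
  refine ⟨fun hbot => ?_⟩
  obtain ⟨K, δ, hK, hδ, h⟩ := eventually_invFilter.1
    (show ∀ᶠ _ in invFilter G, False by rw [hbot]; exact eventually_bot)
  obtain ⟨F, hF, hFinv⟩ := hG K hK δ hδ
  exact h ⟨F, hF⟩ hFinv

theorem tendstoG_iff {f : FinG G → ℝ} {L : ℝ} :
    TendstoG f L ↔ Tendsto f (invFilter G) (𝓝 L) := by
  simp only [Metric.tendsto_nhds, Real.dist_eq, eventually_invFilter, TendstoG, gt_iff_lt]

theorem eventually_lt_of_limsupG_lt {f : FinG G → ℝ} {a : ℝ} (h : limsupG f < a) :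
    ∀ᶠ F in invFilter G, f F < a := by
  simp only [limsupG, iInf_lt_iff] at h
  obtain ⟨K, δ, h⟩ := h
  refine eventually_invFilter.2 ⟨K.1, δ.1, K.2, δ.2, fun F hF => ?_⟩
  exact EReal.coe_lt_coe_iff.1
    ((le_iSup (fun F : {F : FinG G // IsInv K.1 δ.1 F.1} => (f F.1 : EReal)) ⟨F, hF⟩).trans_lt h)

end Invariance

section ErgodicAverage

variable {G : Type*} [Group G] {V : Type*} [SeminormedAddCommGroup V] [NormedSpace ℝ V]
  (π : G →* (V ≃L[ℝ] V))

theorem AF_eq_apply (F : Finset G) (v : V) :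
    AF π F v = ((F.card : ℝ)⁻¹ • ∑ g ∈ F, ((π g⁻¹ : V ≃L[ℝ] V) : V →ₗ[ℝ] V)) v := by
  simp [AF, SF, LinearMap.sum_apply]

theorem AF_add (F : Finset G) (v w : V) : AF π F (v + w) = AF π F v + AF π F w := by
  simp only [AF_eq_apply, map_add]

theorem AF_sub (F : Finset G) (v w : V) : AF π F (v - w) = AF π F v - AF π F w := by
  simp only [AF_eq_apply, map_sub]

variable {π} {C : ℝ}

theorem UnifBdd.norm_SF_le (hπ : UnifBdd π C) (F : Finset G) (v : V) :
    ‖SF π F v‖ ≤ C * ‖v‖ * F.card := by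
  refine (norm_sum_le_of_le F fun g _ => hπ g⁻¹ v).trans (le_of_eq ?_)
  rw [Finset.sum_const, nsmul_eq_mul, mul_comm]

theorem UnifBdd.norm_AF_le (hπ : UnifBdd π C) {F : Finset G} (hF : F.Nonempty) (v : V) :
    ‖AF π F v‖ ≤ C * ‖v‖ := by
  have hc : (0 : ℝ) < F.card := by exact_mod_cast hF.card_pos
  rw [AF, norm_smul, norm_inv, Real.norm_natCast, inv_mul_le_iff₀ hc, mul_comm (F.card : ℝ)]
  exact hπ.norm_SF_le F v

variable [DecidableEq G]

theorem SF_apply_rep (g : G) (F : Finset G) (v : V) : SF π F (π g v) = SF π ({g⁻¹} * F) v := by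
  rw [SF, SF, Finset.singleton_mul, Finset.smul_finset_def,
    Finset.sum_image (MulAction.injective g⁻¹).injOn]
  refine Finset.sum_congr rfl fun h _ => ?_
  rw [smul_eq_mul, mul_inv_rev, inv_inv, map_mul]
  rfl

theorem UnifBdd.norm_SF_sub_SF_le (hπ : UnifBdd π C) (E F : Finset G) (v : V) :
    ‖SF π E v - SF π F v‖ ≤ C * ‖v‖ * (symmDiff E F).card := by
  have hcard : (symmDiff E F).card = (E \ F).card + (F \ E).card :=
    Finset.card_union_of_disjoint disjoint_sdiff_sdiff
  have h : SF π E v - SF π F v = SF π (E \ F) v - SF π (F \ E) v :=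
    (Finset.sum_sdiff_sub_sum_sdiff).symm
  rw [h, hcard]
  refine (norm_sub_le_of_le (hπ.norm_SF_le _ v) (hπ.norm_SF_le _ v)).trans_eq ?_
  push_cast
  ring

theorem UnifBdd.tendsto_AF_coboundary (hπ : UnifBdd π C) (g : G) (v : V) :
    Tendsto (fun F : FinG G => AF π F.1 (π g v - v)) (invFilter G) (𝓝 0) := by
  rw [Metric.tendsto_nhds]
  intro ε hε
  have hD : 0 ≤ C * ‖v‖ := (norm_nonneg _).trans (hπ 1 v)
  refine eventually_invFilter.2 ⟨{g⁻¹}, ε / (C * ‖v‖ + 1), by simp, by positivity, fun F hF => ?_⟩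
  have hc : (0 : ℝ) < F.1.card := by exact_mod_cast F.2.card_pos
  rw [dist_zero_right, AF_sub, AF, AF, ← smul_sub, SF_apply_rep, norm_smul, norm_inv,
    Real.norm_natCast, inv_mul_lt_iff₀ hc]
  calc ‖SF π ({g⁻¹} * F.1) v - SF π F.1 v‖
      ≤ C * ‖v‖ * (symmDiff ({g⁻¹} * F.1) F.1).card := hπ.norm_SF_sub_SF_le _ _ v
    _ ≤ C * ‖v‖ * (ε / (C * ‖v‖ + 1) * F.1.card) := mul_le_mul_of_nonneg_left hF hD
    _ = F.1.card * ε * (C * ‖v‖ / (C * ‖v‖ + 1)) := by ring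
    _ < F.1.card * ε * 1 := by
        gcongr
        rw [div_lt_one (by positivity)]
        linarith
    _ = F.1.card * ε := mul_one _

theorem UnifBdd.tendsto_AF_AF_sub (hπ : UnifBdd π C) {E : Finset G} (hE : E.Nonempty) (v : V) :
    Tendsto (fun F : FinG G => AF π F.1 (AF π E v - v)) (invFilter G) (𝓝 0) := by
  have hc : (E.card : ℝ) ≠ 0 := by exact_mod_cast hE.card_pos.ne'
  have h : AF π E v - v = (E.card : ℝ)⁻¹ • ∑ g ∈ E, (π g⁻¹ v - v) := by
    rw [Finset.sum_sub_distrib, Finset.sum_const, ← Nat.cast_smul_eq_nsmul ℝ, smul_sub,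
      inv_smul_smul₀ hc, AF, SF]
  have h' : Tendsto (fun F : FinG G => (E.card : ℝ)⁻¹ • ∑ g ∈ E, AF π F.1 (π g⁻¹ v - v))
      (invFilter G) (𝓝 ((E.card : ℝ)⁻¹ • ∑ _g ∈ E, (0 : V))) :=
    (tendsto_finsetSum E fun g _ => hπ.tendsto_AF_coboundary g⁻¹ v).const_smul _
  simp only [Finset.sum_const_zero, smul_zero] at h'
  refine h'.congr fun F => ?_
  rw [h]
  simp only [AF_eq_apply, map_smul, map_sum]

theorem UnifBdd.memM_Smap (hπ : UnifBdd π C) (v : V) : MemM π (Smap π v) := by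
  refine ⟨⟨C * ‖v‖, fun F => hπ.norm_SF_le F.1 v⟩, fun g F => ?_⟩
  simp only [Smap, SF, rT, map_sum]
  rw [Finset.sum_image (fun a _ b _ h => mul_right_cancel h)]
  refine Finset.sum_congr rfl fun h _ => ?_
  rw [mul_inv_rev, inv_inv, map_mul]
  rfl

theorem isAdditiveMap_Smap (v : V) : IsAdditiveMap (Smap π v) :=
  fun _ _ h => Finset.sum_union h

/-- The singleton `{a}` as a nonempty finite set. -/
def FinG.singleton {G : Type*} (a : G) : FinG G := ⟨{a}, Finset.singleton_nonempty a⟩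

/-- An additive equivariant set map is determined by its value at `{1}`. -/
theorem IsAdditiveMap.eq_Smap {ψ : FinG G → V} (hψ : IsAdditiveMap ψ) (hπ : IsEquivariant π ψ) :
    ψ = Smap π (ψ (FinG.singleton 1)) := by
  have hsingle (a : G) : ψ (FinG.singleton a) = Smap π (ψ (FinG.singleton 1)) (.singleton a) := by
    have ha : rT a⁻¹ (FinG.singleton 1) = FinG.singleton a :=
      Subtype.ext (by simp only [rT, FinG.singleton, Finset.image_singleton, inv_inv, one_mul])
    rw [← ha, ← hπ, ha]
    exact (Finset.sum_singleton (fun h => π h⁻¹ (ψ (FinG.singleton 1))) a).symm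
  funext ⟨F, hF⟩
  induction hF using Finset.Nonempty.cons_induction with
  | singleton a => exact hsingle a
  | cons a s has hs ih =>
    have hunion : (⟨Finset.cons a s has, Finset.cons_nonempty has⟩ : FinG G) =
        unionF (.singleton a) ⟨s, hs⟩ :=
      Subtype.ext ((Finset.cons_eq_insert a s has).trans (Finset.insert_eq a s))
    have hdisj : Disjoint (FinG.singleton a).1 (⟨s, hs⟩ : FinG G).1 :=
      Finset.disjoint_singleton_left.2 has
    refine (congrArg ψ hunion).trans (Eq.trans ?_ (congrArg _ hunion).symm)
    rw [hψ _ _ hdisj, isAdditiveMap_Smap _ _ _ hdisj, hsingle]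
    exact congrArg _ ih

/-- An approximate realization can be improved by moving it a controlled distance. -/
theorem UnifBdd.exists_approx_near (hG : AmenableG G) (hπ : UnifBdd π C) {f : FinG G → V}
    (hf : ∀ ε : ℝ, 0 < ε → ∃ v : V, ∀ᶠ F in invFilter G, ‖f F - AF π F.1 v‖ < ε)
    {ε : ℝ} (hε : 0 < ε) {v : V} (hv : ∀ᶠ F in invFilter G, ‖f F - AF π F.1 v‖ < ε) :
    ∃ w : V, (∀ᶠ F in invFilter G, ‖f F - AF π F.1 w‖ < ε / 2) ∧ dist v w ≤ 2 * ε := by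
  have := hG.invFilter_neBot
  obtain ⟨v', hv'⟩ := hf (ε / 4) (by positivity)
  obtain ⟨E, hE, hE'⟩ := (hv.and hv').exists
  refine ⟨v' + (AF π E.1 (v' - v) - (v' - v)), ?_, ?_⟩
  · filter_upwards [hv', Metric.tendsto_nhds.1 (hπ.tendsto_AF_AF_sub E.2 (v' - v)) (ε / 4)
      (by positivity)] with F hF hF'
    rw [dist_zero_right] at hF'
    rw [AF_add, ← sub_sub]
    linarith [norm_sub_le (f F - AF π F.1 v') (AF π F.1 (AF π E.1 (v' - v) - (v' - v)))]
  · have hsub : v - (v' + (AF π E.1 (v' - v) - (v' - v))) =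
        (f E - AF π E.1 v') - (f E - AF π E.1 v) := by
      rw [AF_sub]; abel
    rw [dist_eq_norm, hsub]
    linarith [norm_sub_le (f E - AF π E.1 v') (f E - AF π E.1 v)]

/-- A set map that is approximated by ergodic averages to any precision is realized by one. -/
theorem UnifBdd.exists_realization [CompleteSpace V] (hG : AmenableG G) (hπ : UnifBdd π C)
    {f : FinG G → V}
    (hf : ∀ ε : ℝ, 0 < ε → ∃ v : V, ∀ᶠ F in invFilter G, ‖f F - AF π F.1 v‖ < ε) :
    ∃ v : V, Tendsto (fun F : FinG G => ‖f F - AF π F.1 v‖) (invFilter G) (𝓝 0) := by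
  choose! next hnext hdist using fun (ε : ℝ) (hε : 0 < ε) (v : V)
    (hv : ∀ᶠ F in invFilter G, ‖f F - AF π F.1 v‖ < ε) => hπ.exists_approx_near hG hf hε hv
  obtain ⟨v₀, hv₀⟩ := hf 1 one_pos
  let u : ℕ → V := fun n => Nat.rec v₀ (fun n v => next ((1 / 2 : ℝ) ^ n) v) n
  have hu (n : ℕ) : ∀ᶠ F in invFilter G, ‖f F - AF π F.1 (u n)‖ < (1 / 2 : ℝ) ^ n := by
    induction n with
    | zero =>
      rw [pow_zero]
      exact hv₀
    | succ n ih =>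
      rw [pow_succ, mul_one_div]
      exact hnext _ (by positivity) _ ih
  have hcauchy : CauchySeq u :=
    cauchySeq_of_le_geometric (1 / 2) 2 (by norm_num) fun n => hdist _ (by positivity) _ (hu n)
  obtain ⟨w, hw⟩ := cauchySeq_tendsto_of_complete hcauchy
  refine ⟨w, Metric.tendsto_nhds.2 fun ε hε => ?_⟩
  have hsmall : Tendsto (fun n => (1 / 2 : ℝ) ^ n + C * ‖u n - w‖) atTop (𝓝 0) := by
    simpa using (tendsto_pow_atTop_nhds_zero_of_lt_one (r := (1 / 2 : ℝ)) (by norm_num)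
      (by norm_num)).add ((tendsto_iff_norm_sub_tendsto_zero.1 hw).const_mul C)
  obtain ⟨n, hn⟩ := (hsmall.eventually_lt_const hε).exists
  filter_upwards [hu n] with F hF
  rw [dist_zero_right, norm_norm]
  have hsplit : f F - AF π F.1 w = (f F - AF π F.1 (u n)) + AF π F.1 (u n - w) := by
    rw [AF_sub]; abel
  rw [hsplit]
  linarith [norm_add_le (f F - AF π F.1 (u n)) (AF π F.1 (u n - w)),
    hπ.norm_AF_le F.2 (u n - w)]

end ErgodicAverage

theorem statement8 {G : Type*} [Group G] [DecidableEq G] [Countable G]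
    {V : Type*} [SeminormedAddCommGroup V] [NormedSpace ℝ V] [CompleteSpace V]
    (hG : AmenableG G) (π : G →* (V ≃L[ℝ] V)) (C : ℝ) (hπ : UnifBdd π C)
    (φ : FinG G → V) (hφ : MemM π φ)
    (haa : (⨅ ψ : {ψ : FinG G → V // MemM π ψ ∧ IsAdditiveMap ψ},
      limsupG (fun F => ‖(F.1.card : ℝ)⁻¹ • φ F - (F.1.card : ℝ)⁻¹ • ψ.1 F‖)) = (0 : EReal)) :
    ∃ ψ : FinG G → V, MemM π ψ ∧ IsAdditiveMap ψ ∧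
      TendstoG (fun F => ‖(F.1.card : ℝ)⁻¹ • φ F - (F.1.card : ℝ)⁻¹ • ψ F‖) 0 := by
  obtain ⟨v, hv⟩ := hπ.exists_realization hG (f := fun F => (F.1.card : ℝ)⁻¹ • φ F)
    fun ε hε => by
      have hlt := haa.trans_lt (EReal.coe_pos.2 hε)
      obtain ⟨⟨ψ, hψM, hψ⟩, hlt⟩ := iInf_lt_iff.1 hlt
      refine ⟨ψ (.singleton 1), (eventually_lt_of_limsupG_lt hlt).mono fun F hF => ?_⟩
      change ‖_ - (F.1.card : ℝ)⁻¹ • ψ F‖ < ε at hF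
      rw [hψ.eq_Smap hψM.2] at hF
      exact hF
  exact ⟨Smap π v, hπ.memM_Smap v, isAdditiveMap_Smap v, tendstoG_iff.2 hv⟩
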